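/- arXiv:1811.03340 — 4 statements merged into one kernel-verified Lean document; each statement's English description precedes it below -/
import Mathlib

section
/- Let δ > 0 be fixed. For every real α with αδ > 1 there exists a unique k > 0 satisfying k·cosh(kδ) = α·sinh(kδ) (equivalently (kδ)·coth(kδ) = αδ). Moreover there exists α₀ > 0 such that for all α ≥ α₀ this unique solution k satisfies α·tanh(3αδ/4) ≤ k ≤ α. -/
theorem Real.monotone_tanh : Monotone Real.tanh := by
  intro x y hxy
  have h := Real.sinh_nonneg_iff.2 (sub_nonneg.2 hxy)
  rw [Real.sinh_sub] at h
  rw [Real.tanh_eq_sinh_div_cosh, Real.tanh_eq_sinh_div_cosh,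
    div_le_div_iff₀ (Real.cosh_pos x) (Real.cosh_pos y)]
  linarith

theorem Real.strictConvexOn_sinh : StrictConvexOn ℝ (Set.Ici 0) Real.sinh := by
  refine StrictMonoOn.strictConvexOn_of_deriv (convex_Ici 0) Real.continuous_sinh.continuousOn ?_
  rw [Real.deriv_sinh]
  exact Real.cosh_strictMonoOn.mono interior_subset

theorem Real.mul_sinh_lt_mul_sinh {x y : ℝ} (hx : 0 < x) (hxy : x < y) :
    y * Real.sinh x < x * Real.sinh y := by
  have h := Real.strictConvexOn_sinh.secant_strict_mono (a := 0) (x := x) (y := y)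
    (by simp) hx.le (hx.trans hxy).le hx.ne' (hx.trans hxy).ne' hxy
  simp only [Real.sinh_zero, sub_zero] at h
  rw [div_lt_div_iff₀ hx (hx.trans hxy)] at h
  linarith

/-- The function `x ↦ x * coth x` is strictly increasing on the positive reals. -/
theorem Real.mul_cosh_mul_sinh_lt {a b : ℝ} (ha : 0 < a) (hab : a < b) :
    a * Real.cosh a * Real.sinh b < b * Real.cosh b * Real.sinh a := by
  have h := Real.mul_sinh_lt_mul_sinh (sub_pos.2 hab) (show b - a < b + a by linarith)
  rw [Real.sinh_sub, Real.sinh_add] at h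
  linarith

theorem Real.three_mul_cosh_lt_four_mul_sinh {y : ℝ} (hy : 3 < y) :
    3 * Real.cosh y < 4 * Real.sinh y := by
  rw [Real.cosh_eq, Real.sinh_eq]
  have h1 : Real.exp y * Real.exp (-y) = 1 := by rw [← Real.exp_add]; simp
  have h2 := Real.add_one_le_exp y
  have h3 := Real.exp_pos (-y)
  nlinarith

/-- For fixed `δ > 0`: (i) for every `α` with `α * δ > 1` there is a unique `k > 0` with
`k * cosh (k δ) = α * sinh (k δ)` (equivalently `(kδ) coth (kδ) = αδ`); (ii) there is
`α₀ > 0` such that for all `α ≥ α₀` this unique solution satisfies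
`α * tanh (3αδ/4) ≤ k ≤ α`. -/
theorem stmt_2 (δ : ℝ) (hδ : 0 < δ) :
    (∀ α : ℝ, 1 < α * δ →
      ∃! k : ℝ, 0 < k ∧ k * Real.cosh (k * δ) = α * Real.sinh (k * δ)) ∧
    (∃ α₀ : ℝ, 0 < α₀ ∧ ∀ α : ℝ, α₀ ≤ α → ∀ k : ℝ, 0 < k →
      k * Real.cosh (k * δ) = α * Real.sinh (k * δ) →
      α * Real.tanh (3 * α * δ / 4) ≤ k ∧ k ≤ α) := by
  have key : ∀ {k l : ℝ}, 0 < k → k < l →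
      k * Real.cosh (k * δ) * Real.sinh (l * δ) < l * Real.cosh (l * δ) * Real.sinh (k * δ) := by
    intro k l hk hkl
    have h := Real.mul_cosh_mul_sinh_lt (mul_pos hk hδ) (mul_lt_mul_of_pos_right hkl hδ)
    refine lt_of_mul_lt_mul_left ?_ hδ.le
    linarith
  refine ⟨fun α hα => ?_, 5 / δ, by positivity, fun α hα k hk he => ?_⟩
  · have hα0 : 0 < α := by
      by_contra! h
      nlinarith
    obtain ⟨m, hm, hm0, hmα⟩ : ∃ m, Real.cosh (m * δ) < α * δ ∧ 0 < m ∧ m < α := by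
      have hc : Continuous fun m : ℝ => Real.cosh (m * δ) := by fun_prop
      have h1 : ∀ᶠ m in nhdsWithin (0 : ℝ) (Set.Ioi 0), Real.cosh (m * δ) < α * δ :=
        (hc.tendsto 0).mono_left nhdsWithin_le_nhds |>.eventually_lt_const (by simpa using hα)
      exact (h1.and (Ioo_mem_nhdsGT hα0)).exists
    have hcont : ContinuousOn
        (fun k : ℝ => k * Real.cosh (k * δ) - α * Real.sinh (k * δ)) (Set.Icc m α) := by
      fun_prop
    have hneg : m * Real.cosh (m * δ) - α * Real.sinh (m * δ) ≤ 0 := by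
      have h1 := Real.self_le_sinh_iff.2 (mul_pos hm0 hδ).le
      nlinarith
    have hpos : 0 ≤ α * Real.cosh (α * δ) - α * Real.sinh (α * δ) := by
      have h1 := Real.sinh_lt_cosh (α * δ)
      nlinarith
    obtain ⟨k, hk, hk0⟩ := intermediate_value_Icc hmα.le hcont ⟨hneg, hpos⟩
    have hkpos : 0 < k := hm0.trans_le hk.1
    have hke : k * Real.cosh (k * δ) = α * Real.sinh (k * δ) := sub_eq_zero.1 hk0
    refine ⟨k, ⟨hkpos, hke⟩, fun l ⟨hl, hle⟩ => ?_⟩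
    rcases lt_trichotomy l k with h | h | h
    · have := key hl h
      rw [hke, hle] at this
      linarith
    · exact h
    · have := key hkpos h
      rw [hke, hle] at this
      linarith
  · have hαδ : 5 ≤ α * δ := (div_le_iff₀ hδ).1 hα
    have hα0 : 0 < α := lt_of_lt_of_le (by positivity) hα
    have hkα : 3 * α / 4 ≤ k := by
      by_contra! h
      have h1 := key hk h
      have h2 := Real.three_mul_cosh_lt_four_mul_sinh (y := 3 * α / 4 * δ) (by linarith)
      have h3 := mul_pos hα0 (Real.sinh_pos_iff.2 (mul_pos hk hδ))
      rw [he] at h1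
      nlinarith
    have hk_eq : k = α * Real.tanh (k * δ) := by
      rw [Real.tanh_eq_sinh_div_cosh, ← mul_div_assoc, eq_div_iff (Real.cosh_pos _).ne', he]
    constructor
    · have h : Real.tanh (3 * α * δ / 4) ≤ Real.tanh (k * δ) :=
        Real.monotone_tanh (by nlinarith)
      calc α * Real.tanh (3 * α * δ / 4) ≤ α * Real.tanh (k * δ) := by gcongr
        _ = k := hk_eq.symm
    · have h := Real.tanh_lt_one (k * δ)
      nlinarith
end

section
/- Let δ > 0 be fixed. There exist constants c₁ > 0 and α₀ > 0 such that for every α ≥ α₀, the unique k > 0 satisfying k·cosh(kδ) = α·sinh(kδ) obeys 0 ≤ α² − k² ≤ c₁·e^{−δα}. -/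
/-- The elementary bound `x * coth x ≤ 1 + x`, multiplied out. -/
theorem Real.mul_cosh_le_one_add_mul_sinh {x : ℝ} (hx : 0 ≤ x) :
    x * Real.cosh x ≤ (1 + x) * Real.sinh x := by
  have h1 : x ≤ Real.sinh x := Real.self_le_sinh_iff.2 hx
  have h2 : Real.exp (-x) ≤ 1 := Real.exp_le_one_iff.2 (by linarith)
  have h3 := Real.cosh_sub_sinh x
  nlinarith [mul_le_mul_of_nonneg_left h2 hx]

/-- For fixed `δ > 0` there are `c₁ > 0` and `α₀ > 0` such that for all `α ≥ α₀`, the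
unique `k > 0` with `k cosh (kδ) = α sinh (kδ)` obeys `0 ≤ α² - k² ≤ c₁ e^{-δα}`. -/
theorem stmt_3 (δ : ℝ) (hδ : 0 < δ) :
    ∃ c₁ : ℝ, 0 < c₁ ∧ ∃ α₀ : ℝ, 0 < α₀ ∧ ∀ α : ℝ, α₀ ≤ α → ∀ k : ℝ, 0 < k →
      k * Real.cosh (k * δ) = α * Real.sinh (k * δ) →
      0 ≤ α ^ 2 - k ^ 2 ∧ α ^ 2 - k ^ 2 ≤ c₁ * Real.exp (-(δ * α)) := by
  refine ⟨8 * Real.exp 2 / δ ^ 2, by positivity, 1, one_pos, fun α hα k hk h => ?_⟩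
  have hx : 0 < k * δ := mul_pos hk hδ
  have hS : 0 < Real.sinh (k * δ) := Real.sinh_pos_iff.2 hx
  have hC : 0 < Real.cosh (k * δ) := Real.cosh_pos _
  have hsq : (α ^ 2 - k ^ 2) * Real.cosh (k * δ) ^ 2 = α ^ 2 := by
    linear_combination α ^ 2 * Real.cosh_sq_sub_sinh_sq (k * δ) -
      (k * Real.cosh (k * δ) + α * Real.sinh (k * δ)) * h
  have h0 : 0 ≤ α ^ 2 - k ^ 2 :=
    nonneg_of_mul_nonneg_left ((sq_nonneg α).trans_eq hsq.symm) (pow_pos hC 2)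
  refine ⟨h0, ?_⟩
  have hlow : δ * α - 1 ≤ k * δ := by
    have h1 : (δ * α) * Real.sinh (k * δ) ≤ (1 + k * δ) * Real.sinh (k * δ) := by
      linear_combination Real.mul_cosh_le_one_add_mul_sinh hx.le - δ * h
    linarith [le_of_mul_le_mul_right h1 hS]
  have hcosh : Real.exp (δ * α - 1) / 2 ≤ Real.cosh (k * δ) := by
    rw [Real.cosh_eq]
    linarith [Real.exp_le_exp.2 hlow, Real.exp_pos (-(k * δ))]
  have hexp : (δ * α) ^ 2 ≤ 2 * Real.exp (δ * α) := by
    have ht : 0 ≤ δ * α := by positivity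
    linarith [Real.quadratic_le_exp_of_nonneg ht]
  have hmul : (α ^ 2 - k ^ 2) * (Real.exp (δ * α - 1) / 2) ^ 2 ≤ α ^ 2 :=
    (mul_le_mul_of_nonneg_left (pow_le_pow_left₀ (by positivity) hcosh 2) h0).trans_eq hsq
  have he : Real.exp (δ * α - 1) ^ 2 = Real.exp (δ * α) ^ 2 / Real.exp 2 := by
    rw [← Real.exp_nat_mul, ← Real.exp_nat_mul, ← Real.exp_sub]
    congr 1
    push_cast
    ring
  rw [div_pow, he] at hmul
  have hE : 0 < Real.exp (δ * α) := Real.exp_pos _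
  have h2 : 0 < Real.exp 2 := Real.exp_pos _
  have hmain : (α ^ 2 - k ^ 2) * Real.exp (δ * α) ^ 2 ≤ 4 * Real.exp 2 * α ^ 2 := by
    field_simp at hmul
    rw [mul_comm α δ] at hmul
    linarith
  rw [Real.exp_neg, ← div_eq_mul_inv, div_div, le_div_iff₀ (by positivity)]
  refine le_of_mul_le_mul_right ?_ hE
  calc (α ^ 2 - k ^ 2) * (δ ^ 2 * Real.exp (δ * α)) * Real.exp (δ * α)
      = δ ^ 2 * ((α ^ 2 - k ^ 2) * Real.exp (δ * α) ^ 2) := by ring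
    _ ≤ δ ^ 2 * (4 * Real.exp 2 * α ^ 2) := by gcongr
    _ = 4 * Real.exp 2 * (δ * α) ^ 2 := by ring
    _ ≤ 4 * Real.exp 2 * (2 * Real.exp (δ * α)) := by gcongr
    _ = 8 * Real.exp 2 * Real.exp (δ * α) := by ring
end

section
/- Let δ > 0 and 0 ≤ β < α. Define g(k) = (k+α)/(k−α) and h(k) = ((k−β)/(k+β))·e^{2kδ} for k ∈ (α, ∞). Then g is continuous and strictly decreasing on (α,∞) with g(k) → +∞ as k → α⁺ and g(k) → 1 as k → +∞, h is continuous and strictly increasing on (α,∞) with h(k) → e^{2αδ}(α−β)/(α+β) (a finite limit) as k → α⁺ and h(k) → +∞ as k → +∞, and consequently there exists a unique k ∈ (α,∞) with (k+α)(k+β)e^{−kδ} = (k−α)(k−β)e^{kδ}. -/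
open Filter

theorem tendsto_add_div_add_atTop (a b : ℝ) :
    Tendsto (fun k : ℝ => (k + a) / (k + b)) atTop (nhds 1) := by
  have h : Tendsto (fun k : ℝ => 1 + (a - b) / (k + b)) atTop (nhds (1 + 0)) :=
    tendsto_const_nhds.add
      (tendsto_const_nhds.div_atTop (tendsto_atTop_add_const_right _ _ tendsto_id))
  rw [add_zero] at h
  refine h.congr' ?_
  filter_upwards [eventually_gt_atTop (-b)] with k hk
  have : k + b ≠ 0 := by linarith
  field_simp
  ring

theorem strictAntiOn_add_div_sub {a : ℝ} (ha : 0 < a) :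
    StrictAntiOn (fun k : ℝ => (k + a) / (k - a)) (Set.Ioi a) := by
  intro x hx y hy hxy
  rw [Set.mem_Ioi] at hx hy
  change (y + a) / (y - a) < (x + a) / (x - a)
  rw [div_lt_div_iff₀ (by linarith) (by linarith)]
  nlinarith [mul_pos ha (sub_pos.2 hxy)]

theorem tendsto_add_div_sub_nhdsGT {a : ℝ} (ha : 0 < a) :
    Tendsto (fun k : ℝ => (k + a) / (k - a)) (nhdsWithin a (Set.Ioi a)) atTop := by
  have hnum : Tendsto (fun k : ℝ => k + a) (nhdsWithin a (Set.Ioi a)) (nhds (a + a)) :=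
    ((continuous_id.add continuous_const).tendsto a).mono_left nhdsWithin_le_nhds
  have hden : Tendsto (fun k : ℝ => k - a) (nhdsWithin a (Set.Ioi a))
      (nhdsWithin 0 (Set.Ioi 0)) := by
    refine tendsto_nhdsWithin_iff.2 ⟨?_, ?_⟩
    · have : Tendsto (fun k : ℝ => k - a) (nhds a) (nhds (a - a)) :=
        (continuous_id.sub continuous_const).tendsto a
      rw [sub_self] at this
      exact this.mono_left nhdsWithin_le_nhds
    · filter_upwards [self_mem_nhdsWithin] with k hk
      exact sub_pos.2 (Set.mem_Ioi.1 hk)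
  simp only [div_eq_mul_inv]
  exact hnum.pos_mul_atTop (by linarith) hden.inv_tendsto_nhdsGT_zero

theorem continuousOn_sub_div_add_mul_exp {b : ℝ} (δ : ℝ) (hb : 0 ≤ b) :
    ContinuousOn (fun k : ℝ => (k - b) / (k + b) * Real.exp (2 * k * δ)) (Set.Ioi b) := by
  refine ContinuousOn.mul (ContinuousOn.div (by fun_prop) (by fun_prop) ?_) (by fun_prop)
  intro k hk
  rw [Set.mem_Ioi] at hk
  linarith

theorem strictMonoOn_sub_div_add_mul_exp {δ b : ℝ} (hδ : 0 < δ) (hb : 0 ≤ b) :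
    StrictMonoOn (fun k : ℝ => (k - b) / (k + b) * Real.exp (2 * k * δ)) (Set.Ioi b) := by
  intro x hx y hy hxy
  rw [Set.mem_Ioi] at hx hy
  refine mul_lt_mul' ?_ (Real.exp_lt_exp.2 (by nlinarith)) (Real.exp_pos _).le
    (div_pos (by linarith) (by linarith))
  rw [div_le_div_iff₀ (by linarith) (by linarith)]
  nlinarith [mul_nonneg hb (sub_pos.2 hxy).le]

theorem tendsto_sub_div_add_mul_exp_atTop {δ : ℝ} (b : ℝ) (hδ : 0 < δ) :
    Tendsto (fun k : ℝ => (k - b) / (k + b) * Real.exp (2 * k * δ)) atTop atTop := by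
  refine Tendsto.pos_mul_atTop one_pos
    (by simpa only [sub_eq_add_neg] using tendsto_add_div_add_atTop (-b) b) ?_
  exact Real.tendsto_exp_atTop.comp
    ((tendsto_id.const_mul_atTop two_pos).atTop_mul_const hδ)

theorem secular_equation_iff {δ α β k : ℝ} (hα : k - α ≠ 0) (hβ : k + β ≠ 0) :
    (k + α) * (k + β) * Real.exp (-(k * δ)) = (k - α) * (k - β) * Real.exp (k * δ) ↔
      (k + α) / (k - α) = (k - β) / (k + β) * Real.exp (2 * k * δ) := by
  have hexp : Real.exp (2 * k * δ) = Real.exp (k * δ) * Real.exp (k * δ) := by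
    rw [← Real.exp_add]
    ring_nf
  have hne := Real.exp_ne_zero (k * δ)
  rw [hexp, Real.exp_neg, ← div_eq_mul_inv, div_eq_iff hne, div_mul_eq_mul_div,
    div_eq_div_iff hα hβ]
  constructor <;> intro h <;> linarith

/-- A strictly decreasing and a strictly increasing continuous function on `(a, ∞)`, the former
starting above and ending below the latter, agree at exactly one point. -/
theorem existsUnique_eq_of_strictAntiOn_strictMonoOn {g h : ℝ → ℝ} {a l m : ℝ}
    (hg : ContinuousOn g (Set.Ioi a)) (hg' : StrictAntiOn g (Set.Ioi a))
    (hga : Tendsto g (nhdsWithin a (Set.Ioi a)) atTop) (hgt : Tendsto g atTop (nhds l))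
    (hh : ContinuousOn h (Set.Ioi a)) (hh' : StrictMonoOn h (Set.Ioi a))
    (hha : Tendsto h (nhdsWithin a (Set.Ioi a)) (nhds m)) (hht : Tendsto h atTop atTop) :
    ∃! k, k ∈ Set.Ioi a ∧ g k = h k := by
  obtain ⟨x, hxa, hx, hx'⟩ : ∃ x ∈ Set.Ioi a, h x < m + 1 ∧ m + 1 < g x :=
    (eventually_mem_nhdsWithin.and ((hha.eventually_lt_const (lt_add_one m)).and
      (hga.eventually_gt_atTop (m + 1)))).exists
  obtain ⟨y, hxy, hy, hy'⟩ : ∃ y, x < y ∧ g y < l + 1 ∧ l + 1 < h y :=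
    ((eventually_gt_atTop x).and ((hgt.eventually_lt_const (lt_add_one l)).and
      (hht.eventually_gt_atTop (l + 1)))).exists
  have hsub : Set.Icc x y ⊆ Set.Ioi a := fun z hz => lt_of_lt_of_le hxa hz.1
  obtain ⟨k, hk, hk0⟩ := intermediate_value_Icc hxy.le ((hh.sub hg).mono hsub)
    (show (0 : ℝ) ∈ Set.Icc (h x - g x) (h y - g y) from ⟨by linarith, by linarith⟩)
  have hinj : StrictMonoOn (fun z => h z - g z) (Set.Ioi a) := fun u hu v hv huv =>
    sub_lt_sub (hh' hu hv huv) (hg' hu hv huv)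
  refine ⟨k, ⟨hsub hk, (sub_eq_zero.1 hk0).symm⟩, fun z hz => ?_⟩
  exact hinj.injOn hz.1 (hsub hk) ((sub_eq_zero.2 hz.2.symm).trans hk0.symm)

/-- For `δ > 0` and `0 ≤ β < α`, the function `g(k) = (k+α)/(k-α)` is continuous and
strictly decreasing on `(α, ∞)`, tends to `+∞` as `k → α⁺` and to `1` as `k → +∞`;
the function `h(k) = ((k-β)/(k+β)) e^{2kδ}` is continuous and strictly increasing on
`(α, ∞)`, tends to the finite limit `e^{2αδ}(α-β)/(α+β)` as `k → α⁺` and to `+∞` as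
`k → +∞`; consequently there is a unique `k ∈ (α, ∞)` with
`(k+α)(k+β)e^{-kδ} = (k-α)(k-β)e^{kδ}`. -/
theorem stmt_5 (δ α β : ℝ) (hδ : 0 < δ) (hβ : 0 ≤ β) (hβα : β < α) :
    ContinuousOn (fun k : ℝ => (k + α) / (k - α)) (Set.Ioi α) ∧
    StrictAntiOn (fun k : ℝ => (k + α) / (k - α)) (Set.Ioi α) ∧
    Tendsto (fun k : ℝ => (k + α) / (k - α)) (nhdsWithin α (Set.Ioi α)) atTop ∧
    Tendsto (fun k : ℝ => (k + α) / (k - α)) atTop (nhds 1) ∧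
    ContinuousOn (fun k : ℝ => (k - β) / (k + β) * Real.exp (2 * k * δ)) (Set.Ioi α) ∧
    StrictMonoOn (fun k : ℝ => (k - β) / (k + β) * Real.exp (2 * k * δ)) (Set.Ioi α) ∧
    Tendsto (fun k : ℝ => (k - β) / (k + β) * Real.exp (2 * k * δ))
      (nhdsWithin α (Set.Ioi α)) (nhds (Real.exp (2 * α * δ) * (α - β) / (α + β))) ∧
    Tendsto (fun k : ℝ => (k - β) / (k + β) * Real.exp (2 * k * δ)) atTop atTop ∧
    (∃! k : ℝ, k ∈ Set.Ioi α ∧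
      (k + α) * (k + β) * Real.exp (-(k * δ)) = (k - α) * (k - β) * Real.exp (k * δ)) := by
  have hα : 0 < α := hβ.trans_lt hβα
  have hsub : Set.Ioi α ⊆ Set.Ioi β := Set.Ioi_subset_Ioi hβα.le
  have hg : ContinuousOn (fun k : ℝ => (k + α) / (k - α)) (Set.Ioi α) :=
    ContinuousOn.div (by fun_prop) (by fun_prop) fun k hk => (sub_pos.2 hk).ne'
  have hg' := strictAntiOn_add_div_sub hα
  have hga := tendsto_add_div_sub_nhdsGT hα
  have hgt : Tendsto (fun k : ℝ => (k + α) / (k - α)) atTop (nhds 1) := by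
    simpa only [sub_eq_add_neg] using tendsto_add_div_add_atTop α (-α)
  have hh := continuousOn_sub_div_add_mul_exp δ hβ
  have hh' := (strictMonoOn_sub_div_add_mul_exp hδ hβ).mono hsub
  have hha : Tendsto (fun k : ℝ => (k - β) / (k + β) * Real.exp (2 * k * δ))
      (nhdsWithin α (Set.Ioi α)) (nhds (Real.exp (2 * α * δ) * (α - β) / (α + β))) := by
    have h := (hh.continuousAt (Ioi_mem_nhds hβα)).tendsto.mono_left
      (nhdsWithin_le_nhds (s := Set.Ioi α))
    rwa [div_mul_eq_mul_div, mul_comm (α - β)] at h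
  have hht := tendsto_sub_div_add_mul_exp_atTop β hδ
  refine ⟨hg, hg', hga, hgt, hh.mono hsub, hh', hha, hht, ?_⟩
  refine (existsUnique_congr fun k => and_congr_right fun hk => ?_).2
    (existsUnique_eq_of_strictAntiOn_strictMonoOn hg hg' hga hgt (hh.mono hsub) hh' hha hht)
  rw [Set.mem_Ioi] at hk
  exact secular_equation_iff (by linarith) (by linarith)
end

section
/- Let δ > 0 and β ≥ 0 be fixed. There exist constants c > 0 and α₀ > β such that for every α ≥ α₀, the unique solution k ∈ (α, ∞) of (k+α)(k+β)e^{−kδ} = (k−α)(k−β)e^{kδ} satisfies (k+α)/(k−α) ≥ e^{3αδ/2}, hence k ≤ α·(1+e^{−3αδ/2})/(1−e^{−3αδ/2}), and therefore 0 < k² − α² ≤ c·e^{−δα}. -/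
/-- For fixed `δ > 0` and `β ≥ 0` there are `c > 0` and `α₀ > β` such that for every
`α ≥ α₀`, the unique solution `k ∈ (α, ∞)` of `(k+α)(k+β)e^{-kδ} = (k-α)(k-β)e^{kδ}`
satisfies `(k+α)/(k-α) ≥ e^{3αδ/2}`, hence
`k ≤ α (1+e^{-3αδ/2})/(1-e^{-3αδ/2})`, and therefore `0 < k² - α² ≤ c e^{-δα}`. -/
theorem stmt_6 (δ β : ℝ) (hδ : 0 < δ) (hβ : 0 ≤ β) :
    ∃ c : ℝ, 0 < c ∧ ∃ α₀ : ℝ, β < α₀ ∧ ∀ α : ℝ, α₀ ≤ α → ∀ k : ℝ, α < k →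
      (k + α) * (k + β) * Real.exp (-(k * δ)) = (k - α) * (k - β) * Real.exp (k * δ) →
      Real.exp (3 * α * δ / 2) ≤ (k + α) / (k - α) ∧
      k ≤ α * (1 + Real.exp (-(3 * α * δ / 2))) / (1 - Real.exp (-(3 * α * δ / 2))) ∧
      0 < k ^ 2 - α ^ 2 ∧ k ^ 2 - α ^ 2 ≤ c * Real.exp (-(δ * α)) := by
  refine ⟨72 / δ ^ 2, by positivity, 3 * β + 2 / δ, ?_, ?_⟩
  · have : 0 < 2 / δ := by positivity
    linarith
  intro α hα k hk heq
  have hδ2 : 0 < 2 / δ := by positivity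
  have hαβ : 3 * β < α := by linarith
  have hα0 : 0 < α := by linarith
  have hαδ : 1 ≤ α * δ / 2 := by
    have h : 2 / δ ≤ α := by linarith
    rw [div_le_iff₀ hδ] at h
    linarith
  set E := Real.exp (α * δ / 2) with hE
  have hE0 : 0 < E := Real.exp_pos _
  have hquad : 1 + α * δ / 2 + (α * δ / 2) ^ 2 / 2 ≤ E :=
    Real.quadratic_le_exp_of_nonneg (by linarith)
  have hE2 : 2 ≤ E := by nlinarith [sq_nonneg (α * δ / 2)]
  have hE3 : Real.exp (3 * α * δ / 2) = E ^ 3 := by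
    rw [hE, ← Real.exp_nat_mul]
    congr 1
    push_cast
    ring
  have hE4 : E ^ 4 ≤ Real.exp (2 * k * δ) := by
    rw [hE, ← Real.exp_nat_mul, Real.exp_le_exp]
    push_cast
    nlinarith
  have hEδ : Real.exp (-(δ * α)) = (E ^ 2)⁻¹ := by
    rw [Real.exp_neg, hE, ← Real.exp_nat_mul]
    congr 2
    push_cast
    ring
  have heq' : (k + α) * (k + β) = (k - α) * (k - β) * Real.exp (2 * k * δ) := by
    have h1 : Real.exp (-(k * δ)) * Real.exp (k * δ) = 1 := by
      rw [← Real.exp_add]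
      simp
    have h2 : Real.exp (2 * k * δ) = Real.exp (k * δ) * Real.exp (k * δ) := by
      rw [← Real.exp_add]
      congr 1
      ring
    calc (k + α) * (k + β)
        = (k + α) * (k + β) * Real.exp (-(k * δ)) * Real.exp (k * δ) := by
          rw [mul_assoc _ (Real.exp _), h1, mul_one]
      _ = _ := by rw [heq, h2]; ring
  have hkα : 0 < k - α := by linarith
  have hkβ : 0 < k - β := by linarith
  have hkβ' : 0 < k + β := by linarith
  have key : E ^ 3 * (k - α) ≤ k + α := by
    refine le_of_mul_le_mul_right ?_ hkβ'
    calc E ^ 3 * (k - α) * (k + β) ≤ E ^ 3 * (k - α) * (2 * (k - β)) := by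
          gcongr
          linarith
      _ ≤ E ^ 3 * (k - α) * (E * (k - β)) := by gcongr
      _ = (k - α) * (k - β) * E ^ 4 := by ring
      _ ≤ (k - α) * (k - β) * Real.exp (2 * k * δ) := by gcongr
      _ = (k + α) * (k + β) := heq'.symm
  have hE8 : 8 ≤ E ^ 3 := by
    calc (8 : ℝ) = 2 ^ 3 := by norm_num
      _ ≤ E ^ 3 := by gcongr
  have hk2 : k ≤ 2 * α := by nlinarith
  have hinv : (E ^ 3)⁻¹ ≤ 1 / 8 := by
    rw [inv_le_comm₀ (by positivity) (by norm_num)]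
    linarith
  have key' : k - α ≤ (E ^ 3)⁻¹ * (k + α) := by
    rw [inv_mul_eq_div, le_div_iff₀ (by positivity)]
    linarith
  refine ⟨?_, ?_, by nlinarith, ?_⟩
  · rw [hE3, le_div_iff₀ hkα]
    exact key
  · rw [Real.exp_neg, hE3, le_div_iff₀ (by linarith)]
    linarith
  · have hαE : α ^ 2 ≤ 8 / δ ^ 2 * E := by
      rw [div_mul_eq_mul_div, le_div_iff₀ (by positivity)]
      nlinarith
    rw [hEδ]
    calc k ^ 2 - α ^ 2 = (k - α) * (k + α) := by ring
      _ ≤ (E ^ 3)⁻¹ * (k + α) * (k + α) := by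
          gcongr
          linarith
      _ ≤ (E ^ 3)⁻¹ * (3 * α) * (3 * α) := by
          gcongr <;> linarith
      _ = 9 * (E ^ 3)⁻¹ * α ^ 2 := by ring
      _ ≤ 9 * (E ^ 3)⁻¹ * (8 / δ ^ 2 * E) := by gcongr
      _ = 72 / δ ^ 2 * (E ^ 2)⁻¹ := by
          field_simp
          norm_num
end
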